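/- arXiv:1306.0747 — 2 statements merged into one kernel-verified Lean document; each statement's English description precedes it below -/
import Mathlib

section
/- Let G be a finite group, let μ be a set of primes, let p be a prime not in μ, and let π be the disjoint union μ ∪ {p}. Suppose G is μ-solvable and d_μ(G) = 1, and let H be a Hall μ-subgroup of G. Then d_π(G) = (1/|H|) · Σ_{h ∈ H} k_p(C_G(h))/|G|_p, where C_G(h) is the centralizer of h in G. -/
open scoped Classical Pointwise

/-- A `π`-element: every prime divisor of its order lies in `π`. -/
def IsPiElement {G : Type*} [Group G] (π : Set ℕ) (x : G) : Prop :=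
  ∀ q : ℕ, q.Prime → q ∣ orderOf x → q ∈ π

/-- `kPi π G` is the number of conjugacy classes of `π`-elements of `G`. -/
noncomputable def kPi (π : Set ℕ) (G : Type*) [Group G] : ℕ :=
  Nat.card {c : ConjClasses G | ∃ x : G, ConjClasses.mk x = c ∧ IsPiElement π x}

/-- The `π`-part of a natural number: the largest divisor all of whose prime
divisors lie in `π`. -/
noncomputable def piPart (π : Set ℕ) (n : ℕ) : ℕ :=
  n.factorization.prod fun p k => if p ∈ π then p ^ k else 1

/-- `dPi π G = kPi π G / |G|_π`. -/
noncomputable def dPi (π : Set ℕ) (G : Type*) [Group G] : ℚ :=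
  (kPi π G : ℚ) / (piPart π (Nat.card G) : ℚ)

/-- `s` is a composition series of `G`: a chain from `⊥` to `⊤` in which each
term is normal in the next with simple quotient. -/
def IsCompositionSeries {G : Type*} [Group G] {n : ℕ}
    (s : Fin (n + 1) → Subgroup G) : Prop :=
  s 0 = ⊥ ∧ s (Fin.last n) = ⊤ ∧
    ∀ i : Fin n, s i.castSucc ≤ s i.succ ∧
      ∃ hn : ((s i.castSucc).subgroupOf (s i.succ)).Normal,
        letI := hn
        IsSimpleGroup (s i.succ ⧸ (s i.castSucc).subgroupOf (s i.succ))

/-- `G` is `π`-solvable: every composition factor of `G` either has order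
coprime to every prime in `π`, or is cyclic of prime order `p` for some
`p ∈ π`. -/
def IsPiSolvable (π : Set ℕ) (G : Type*) [Group G] : Prop :=
  ∀ (n : ℕ) (s : Fin (n + 1) → Subgroup G) (hs : IsCompositionSeries s),
    ∀ i : Fin n,
      (∀ q ∈ π, ¬ q ∣ Nat.card (s i.succ ⧸ (s i.castSucc).subgroupOf (s i.succ))) ∨
      (∃ p ∈ π, p.Prime ∧
        Nat.card (s i.succ ⧸ (s i.castSucc).subgroupOf (s i.succ)) = p ∧
        letI := (hs.2.2 i).2.choose
        IsCyclic (s i.succ ⧸ (s i.castSucc).subgroupOf (s i.succ)))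


lemma dpi_conj_aux {G : Type*} [Group G] [Finite G] (n : ℕ) :
    ∀ (N : Subgroup G) (x y : G), (∀ m ∈ N, x * m * x⁻¹ ∈ N) → y * x⁻¹ ∈ N →
      x ^ n = 1 → y ^ n = 1 → n.Coprime (Nat.card N) → ∃ g ∈ N, g * x * g⁻¹ = y := by
  induction n using Nat.recOnPosPrimePosCoprime with
  | zero =>
    intro N x y _ h _ _ hc
    rw [Nat.coprime_zero_left] at hc
    have hN := Subgroup.card_eq_one.mp hc
    subst hN
    rw [Subgroup.mem_bot] at h
    exact ⟨1, one_mem _, by simpa using (mul_inv_eq_one.mp h).symm⟩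
  | one =>
    intro N x y _ _ hx hy _
    refine ⟨1, one_mem _, ?_⟩
    simp_all
  | prime_pow q a hq ha =>
    intro N x y hn h hx hy hc
    have := Fact.mk hq
    have hc' : ¬ q ∣ Nat.card N := by
      rw [Nat.coprime_pow_left_iff ha] at hc
      exact (Nat.Prime.coprime_iff_not_dvd hq).mp hc
    have hmem : ∀ m ∈ N, y * m * x⁻¹ ∈ N := by
      intro m hm
      have := N.mul_mem h (hn m hm)
      simpa [mul_assoc] using this
    let f : Function.End N := fun m => ⟨y * m * x⁻¹, hmem m m.2⟩
    have hf : ∀ (k : ℕ) (m : N), (((f ^ k) m : N) : G) = y ^ k * m * (x ^ k)⁻¹ := by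
      intro k
      induction k with
      | zero => intro m; simp; rfl
      | succ k ih =>
        intro m
        rw [pow_succ']
        change y * (((f ^ k) m : N) : G) * x⁻¹ = _
        rw [ih]
        simp [pow_succ', mul_assoc]
    have hf1 : f ^ (q ^ a) = 1 := by
      funext m
      apply Subtype.ext
      rw [hf, hx, hy]
      simp; rfl
    have := Fintype.ofFinite N
    have hm := Equiv.Perm.card_fixedPoints_modEq hf1
    have hne : Fintype.card (Function.fixedPoints f) ≠ 0 := by
      intro h0
      rw [h0] at hm
      apply hc'
      rw [Nat.card_eq_fintype_card]
      exact (Nat.modEq_zero_iff_dvd).mp hm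
    obtain ⟨m, hm⟩ := Fintype.card_pos_iff.mp (Nat.pos_of_ne_zero hne)
    refine ⟨m, m.2, ?_⟩
    have hm' : y * (m : G) * x⁻¹ = m := congrArg Subtype.val hm
    rw [mul_inv_eq_iff_eq_mul] at hm' ⊢
    exact hm'.symm
  | coprime a b ha hb hab iha ihb =>
    intro N x y hn h hx hy hc
    obtain ⟨e, he1, he0⟩ := Nat.chineseRemainder hab 1 0
    have hac : a.Coprime (Nat.card N) := Nat.Coprime.coprime_mul_right hc
    have hbc : b.Coprime (Nat.card N) := Nat.Coprime.coprime_mul_left hc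
    have hbe : b ∣ e := (Nat.modEq_zero_iff_dvd).mp he0
    have key : ∀ z : G, z ^ (a * b) = 1 → (z ^ e) ^ a = 1 ∧ (z * (z ^ e)⁻¹) ^ b = 1 := by
      intro z hz
      have h1 : (z ^ e) ^ a = 1 := by
        obtain ⟨c, rfl⟩ := hbe
        rw [← pow_mul, show b * c * a = a * b * c by ring, pow_mul, hz, one_pow]
      refine ⟨h1, ?_⟩
      have h2 : z ^ (b * e) = z ^ b := by
        have hh : b * e ≡ b * 1 [MOD orderOf z] := by
          refine Nat.ModEq.of_dvd (orderOf_dvd_of_pow_eq_one hz) ?_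
          rw [mul_comm a b]
          exact Nat.ModEq.mul_left' b he1
        have := pow_eq_pow_iff_modEq.mpr hh
        simpa using this
      have hcm : Commute z (z ^ e)⁻¹ := (Commute.self_pow z e).inv_right
      rw [hcm.mul_pow, inv_pow, ← pow_mul, mul_comm e b, h2, mul_inv_cancel]
    have hnk : ∀ k : ℕ, (∀ m ∈ N, x ^ k * m * (x ^ k)⁻¹ ∈ N) ∧ y ^ k * (x ^ k)⁻¹ ∈ N := by
      intro k
      induction k with
      | zero => simp
      | succ k ih =>
        constructor
        · intro m hm
          have := hn _ (ih.1 m hm)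
          simpa [pow_succ', mul_assoc] using this
        · have := N.mul_mem h (hn _ ih.2)
          simpa [pow_succ', mul_assoc] using this
    obtain ⟨g, hg, hgx⟩ := iha N (x ^ e) (y ^ e) (hnk e).1 (hnk e).2 (key x hx).1 (key y hy).1 hac
    obtain ⟨x', hx'⟩ : ∃ x', x' = g * x * g⁻¹ := ⟨_, rfl⟩
    have hu : x' ^ e = y ^ e := by rw [hx', conj_pow, hgx]
    have hx'n : x' ^ (a * b) = 1 := by rw [hx', conj_pow, hx]; simp
    have hn' : ∀ m ∈ N, x' * m * x'⁻¹ ∈ N := by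
      intro m hm
      have := N.mul_mem (N.mul_mem hg (hn _ (N.mul_mem (N.mul_mem (N.inv_mem hg) hm) hg)))
        (N.inv_mem hg)
      rw [hx']
      simpa [mul_assoc] using this
    have h' : y * x'⁻¹ ∈ N := by
      have := N.mul_mem (N.mul_mem h (hn _ hg)) (N.inv_mem hg)
      rw [hx']
      simpa [mul_assoc] using this
    have cx : Commute x' (y ^ e) := hu ▸ Commute.self_pow x' e
    have cy : Commute y (y ^ e) := Commute.self_pow y e
    have memc : ∀ z : G, z ∈ Subgroup.centralizer {y ^ e} ↔ Commute z (y ^ e) := by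
      intro z
      rw [Subgroup.mem_centralizer_singleton_iff]; rfl
    obtain ⟨g', hg', hgg⟩ := ihb (N ⊓ Subgroup.centralizer {y ^ e}) (x' * (y ^ e)⁻¹)
      (y * (y ^ e)⁻¹) (by
        rintro m ⟨hm, hm2⟩
        have hm2' := (memc m).mp hm2
        have : x' * (y ^ e)⁻¹ * m * (x' * (y ^ e)⁻¹)⁻¹ = x' * m * x'⁻¹ := by
          have : (y ^ e)⁻¹ * m = m * (y ^ e)⁻¹ := hm2'.symm.inv_left.eq
          simp only [mul_assoc, mul_inv_rev, inv_inv]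
          rw [← mul_assoc (y ^ e)⁻¹ m, this]
          simp [mul_assoc]
        rw [this]
        exact ⟨hn' m hm, (memc _).mpr ((cx.mul_left hm2').mul_left cx.inv_left)⟩)
      (by
        have : y * (y ^ e)⁻¹ * (x' * (y ^ e)⁻¹)⁻¹ = y * x'⁻¹ := by simp [mul_assoc]
        rw [this]
        exact ⟨h', (memc _).mpr (cy.mul_left cx.inv_left)⟩)
      (by rw [← hu]; exact (key x' hx'n).2) (key y hy).2
      (Nat.Coprime.coprime_dvd_right (Subgroup.card_dvd_of_le inf_le_left) hbc)
    refine ⟨g' * g, N.mul_mem hg'.1 hg, ?_⟩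
    have c := (memc _).mp hg'.2
    have e1 : g' * g * x * (g' * g)⁻¹ = g' * x' * g'⁻¹ := by rw [hx']; simp [mul_assoc]
    have e2 : (y ^ e)⁻¹ * g'⁻¹ = g'⁻¹ * (y ^ e)⁻¹ := by
      have := c.inv_left.inv_right.eq
      exact this.symm
    rw [e1]
    have e3 : g' * x' * g'⁻¹ * (y ^ e)⁻¹ = y * (y ^ e)⁻¹ := by
      rw [← hgg]; simp only [mul_assoc]; rw [e2]
    exact mul_right_cancel e3

/-- all prime divisors of `n` satisfy `P` -/
def PrimesIn (P : ℕ → Prop) (n : ℕ) : Prop := ∀ q : ℕ, q.Prime → q ∣ n → P q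

lemma PrimesIn.of_dvd {P : ℕ → Prop} {m n : ℕ} (h : PrimesIn P n) (hd : m ∣ n) : PrimesIn P m :=
  fun q hq hqm => h q hq (hqm.trans hd)

lemma PrimesIn.mul {P : ℕ → Prop} {m n : ℕ} (h : PrimesIn P m) (h' : PrimesIn P n) :
    PrimesIn P (m * n) :=
  fun q hq hqm => (hq.dvd_mul.mp hqm).elim (h q hq) (h' q hq)

lemma PrimesIn.coprime {P : ℕ → Prop} {m n : ℕ} (h : PrimesIn P m)
    (h' : PrimesIn (fun q => ¬ P q) n) : m.Coprime n :=
  Nat.coprime_of_dvd fun q hq h1 h2 => h' q hq h2 (h q hq h1)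

inductive SubSep (μ : Set ℕ) {G : Type*} [Group G] : Subgroup G → Prop
  | bot : SubSep μ ⊥
  | step (K L : Subgroup G) : SubSep μ K → K ≤ L → L ≤ Subgroup.normalizer (K : Set G) →
      (PrimesIn (· ∈ μ) (K.relIndex L) ∨ PrimesIn (fun q => ¬ q ∈ μ) (K.relIndex L)) → SubSep μ L

lemma SubSep.map {μ : Set ℕ} {G G' : Type*} [Group G] [Group G'] (f : G →* G') {L : Subgroup G}
    (h : SubSep μ L) : SubSep μ (L.map f) := by
  induction h with
  | bot => rw [Subgroup.map_bot]; exact SubSep.bot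
  | step K L _ hle hn hc ih =>
    refine SubSep.step (K.map f) (L.map f) ih (Subgroup.map_mono hle) ?_ ?_
    · exact (Subgroup.map_mono hn).trans (Subgroup.le_normalizer_map f)
    · have : (K.map f).relIndex (L.map f) ∣ K.relIndex L := by
        rw [← Subgroup.relIndex_comap, Subgroup.comap_map_eq]
        exact Subgroup.relIndex_dvd_of_le_left L (le_sup_left : K ≤ K ⊔ f.ker)
      exact hc.imp (·.of_dvd this) (·.of_dvd this)

lemma card_sup_primesIn {G : Type*} [Group G] [Finite G] {P : ℕ → Prop} {N M : Subgroup G}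
    (h : N ≤ Subgroup.normalizer (M : Set G)) (hN : PrimesIn P (Nat.card N))
    (hM : PrimesIn P (Nat.card M)) : PrimesIn P (Nat.card (N ⊔ M : Subgroup G)) := by
  have hM' : M ≤ Subgroup.normalizer (M : Set G) := Subgroup.le_normalizer
  have e : M.relIndex (N ⊔ M) ∣ Nat.card N := by
    rw [← Subgroup.relIndex_subgroupOf (sup_le h hM'), Subgroup.subgroupOf_sup h hM',
      Subgroup.relIndex_sup_right, Subgroup.relIndex_subgroupOf h]
    exact Subgroup.relIndex_dvd_card M N
  have := Subgroup.relIndex_mul_relIndex ⊥ M (N ⊔ M) bot_le le_sup_right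
  rw [Subgroup.relIndex_bot_left, Subgroup.relIndex_bot_left] at this
  rw [← this]
  exact hM.mul (hN.of_dvd e)

lemma exists_max_normal {G : Type*} [Group G] [Finite G] (P : ℕ → Prop) (K : Subgroup G) :
    ∃ N : Subgroup G, N ≤ K ∧ K ≤ Subgroup.normalizer (N : Set G) ∧ PrimesIn P (Nat.card N) ∧
      ∀ M : Subgroup G, M ≤ K → K ≤ Subgroup.normalizer (M : Set G) →
        PrimesIn P (Nat.card M) → M ≤ N := by
  let S : Set (Subgroup G) := {N | N ≤ K ∧ K ≤ Subgroup.normalizer (N : Set G) ∧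
    PrimesIn P (Nat.card N)}
  have hS : S.Nonempty := ⟨⊥, bot_le, by rw [Subgroup.normalizer_eq_top]; exact le_top, by
    intro q hq h; simp at h; exact absurd h hq.ne_one⟩
  obtain ⟨N, hN, hmax⟩ := (Set.toFinite S).exists_maximal hS
  refine ⟨N, hN.1, hN.2.1, hN.2.2, fun M h1 h2 h3 => ?_⟩
  have hsup : N ⊔ M ∈ S := by
    refine ⟨sup_le hN.1 h1, ?_, ?_⟩
    · intro g hg
      have a := hN.2.1 hg
      have b := h2 hg
      rw [Subgroup.mem_normalizer_iff_map_conj_eq] at a b ⊢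
      rw [Subgroup.map_sup, a, b]
    · exact card_sup_primesIn (hN.1.trans h2) hN.2.2 h3
  exact le_sup_right.trans (hmax hsup le_sup_left)

lemma exists_normal_step {G : Type*} [Group G] [Finite G] (P : ℕ → Prop) {K L M : Subgroup G}
    (hKL : K ≤ L) (hL : L ≤ Subgroup.normalizer (K : Set G)) (hM : M ≠ ⊥) (h1 : M ≤ K)
    (h2 : K ≤ Subgroup.normalizer (M : Set G)) (h3 : PrimesIn P (Nat.card M)) :
    ∃ N : Subgroup G, N ≠ ⊥ ∧ N ≤ L ∧ L ≤ Subgroup.normalizer (N : Set G) ∧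
      PrimesIn P (Nat.card N) := by
  obtain ⟨N, n1, n2, n3, n4⟩ := exists_max_normal P K
  refine ⟨N, ?_, n1.trans hKL, ?_, n3⟩
  · rintro rfl
    exact hM (le_bot_iff.mp (n4 M h1 h2 h3))
  · intro g hg
    have hgK := hL hg
    rw [Subgroup.mem_normalizer_iff_map_conj_eq] at hgK ⊢
    have hcard : Nat.card (N.map (MulAut.conj g : G →* G)) = Nat.card N :=
      Subgroup.card_map_of_injective (MulAut.conj g).injective
    have hle : N.map (MulAut.conj g : G →* G) ≤ N := by
      apply n4
      · rw [← hgK]; exact Subgroup.map_mono n1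
      · have := (Subgroup.map_mono (f := (MulAut.conj g : G →* G)) n2).trans
          (Subgroup.le_normalizer_map _)
        rw [hgK] at this
        exact this
      · rw [hcard]; exact n3
    exact Subgroup.eq_of_le_of_card_ge hle hcard.ge

lemma SubSep.exists_normal {μ : Set ℕ} {G : Type*} [Group G] [Finite G] {L : Subgroup G}
    (h : SubSep μ L) (hL : L ≠ ⊥) : ∃ N : Subgroup G, N ≠ ⊥ ∧ N ≤ L ∧
      L ≤ Subgroup.normalizer (N : Set G) ∧
      (PrimesIn (· ∈ μ) (Nat.card N) ∨ PrimesIn (fun q => ¬ q ∈ μ) (Nat.card N)) := by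
  induction h with
  | bot => exact absurd rfl hL
  | step K L _ hle hn hc ih =>
    by_cases hK : K = ⊥
    · subst hK
      rw [Subgroup.relIndex_bot_left] at hc
      exact ⟨L, hL, le_rfl, Subgroup.le_normalizer, hc⟩
    · obtain ⟨M, m1, m2, m3, m4⟩ := ih hK
      rcases m4 with m4 | m4
      · obtain ⟨N, a, b, c, d⟩ := exists_normal_step _ hle hn m1 m2 m3 m4
        exact ⟨N, a, b, c, Or.inl d⟩
      · obtain ⟨N, a, b, c, d⟩ := exists_normal_step _ hle hn m1 m2 m3 m4
        exact ⟨N, a, b, c, Or.inr d⟩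

lemma exists_conj_mem_hall.{u} (μ : Set ℕ) (n : ℕ) : ∀ (G : Type u) [Group G] [Finite G],
    Nat.card G = n → SubSep μ (⊤ : Subgroup G) → ∀ (H : Subgroup G),
    PrimesIn (· ∈ μ) (Nat.card H) → PrimesIn (fun q => ¬ q ∈ μ) H.index →
    ∀ x : G, PrimesIn (· ∈ μ) (orderOf x) → ∃ g : G, g * x * g⁻¹ ∈ H := by
  induction n using Nat.strong_induction_on with
  | _ n ih =>
  intro G _ _ hn hsep H hH hI x hx
  by_cases hG : (⊤ : Subgroup G) = ⊥
  · refine ⟨1, ?_⟩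
    have : x ∈ (⊥ : Subgroup G) := hG ▸ Subgroup.mem_top x
    rw [Subgroup.mem_bot] at this
    subst this
    simp [one_mem]
  obtain ⟨N, hN, -, hnorm, hc⟩ := hsep.exists_normal hG
  have hNn : N.Normal := Subgroup.normalizer_eq_top_iff.mp (top_le_iff.mp hnorm)
  have hsurj := QuotientGroup.mk'_surjective N
  have hlt : Nat.card (G ⧸ N) < n := by
    rw [← hn, Subgroup.card_eq_card_quotient_mul_card_subgroup N]
    have := (Subgroup.one_lt_card_iff_ne_bot N).mpr hN
    have h0 : 0 < Nat.card (G ⧸ N) := Nat.card_pos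
    nlinarith
  have hsep' : SubSep μ (⊤ : Subgroup (G ⧸ N)) := by
    have := hsep.map (QuotientGroup.mk' N)
    rwa [Subgroup.map_top_of_surjective _ hsurj] at this
  obtain ⟨g', hg'⟩ := ih _ hlt (G ⧸ N) rfl hsep' (H.map (QuotientGroup.mk' N))
    (hH.of_dvd (Subgroup.card_map_dvd H _)) (hI.of_dvd (Subgroup.index_map_dvd H hsurj))
    (QuotientGroup.mk' N x) (hx.of_dvd (orderOf_map_dvd _ x))
  obtain ⟨g, rfl⟩ := hsurj g'
  have hmem : g * x * g⁻¹ ∈ H ⊔ N := by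
    have h1 : g * x * g⁻¹ ∈ (H.map (QuotientGroup.mk' N)).comap (QuotientGroup.mk' N) := by
      rw [Subgroup.mem_comap, map_mul, map_mul, map_inv]; exact hg'
    rwa [Subgroup.comap_map_eq, QuotientGroup.ker_mk'] at h1
  rcases hc with hc | hc
  · refine ⟨g, ?_⟩
    have h1 : PrimesIn (· ∈ μ) (Nat.card (H ⊔ N : Subgroup G)) :=
      card_sup_primesIn (le_top.trans hnorm) hH hc
    have h2 : (H.relIndex (H ⊔ N)).Coprime (H.relIndex (H ⊔ N)) :=
      (h1.of_dvd (Subgroup.relIndex_dvd_card H _)).coprime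
        (hI.of_dvd (Subgroup.relIndex_dvd_index_of_le le_sup_left))
    rw [Nat.coprime_self, Subgroup.relIndex_eq_one] at h2
    exact h2 hmem
  · obtain ⟨h, hh, m, hm, hx'⟩ := Subgroup.mem_sup_of_normal_right.mp hmem
    have hord : orderOf (g * x * g⁻¹) = orderOf x := by
      simpa using orderOf_injective (MulAut.conj g : G →* G) (MulAut.conj g).injective x
    have hho : PrimesIn (· ∈ μ) (orderOf h) := hH.of_dvd (Subgroup.orderOf_dvd_natCard H hh)
    obtain ⟨k, hk, hkx⟩ := dpi_conj_aux (orderOf x * orderOf h) N (g * x * g⁻¹) h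
      (fun m hm => hNn.conj_mem m hm _) (by
        rw [← hx']
        have := hNn.conj_mem _ (N.inv_mem hm) h
        simpa [mul_assoc] using this)
      (by rw [pow_mul, ← hord, pow_orderOf_eq_one, one_pow])
      (by rw [mul_comm, pow_mul, pow_orderOf_eq_one, one_pow])
      ((hx.mul hho).coprime hc)
    refine ⟨k * g, ?_⟩
    have : k * g * x * (k * g)⁻¹ = h := by rw [← hkx]; simp [mul_assoc]
    rw [this]; exact hh

lemma exists_comp_series {G : Type*} [Group G] [Finite G] (c : ℕ) : ∀ L : Subgroup G,
    Nat.card L = c → ∃ (n : ℕ) (s : Fin (n + 1) → Subgroup G),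
    s 0 = ⊥ ∧ s (Fin.last n) = L ∧
    ∀ i : Fin n, s i.castSucc ≤ s i.succ ∧
      ∃ hn : ((s i.castSucc).subgroupOf (s i.succ)).Normal,
        letI := hn
        IsSimpleGroup (s i.succ ⧸ (s i.castSucc).subgroupOf (s i.succ)) := by
  induction c using Nat.strong_induction_on with
  | _ c ih =>
  intro L hL
  by_cases hb : L = ⊥
  · subst hb
    exact ⟨0, fun _ => ⊥, rfl, rfl, fun i => i.elim0⟩
  let S : Set (Subgroup L) := {K | K.Normal ∧ K ≠ ⊤}
  have hS : S.Nonempty := ⟨⊥, inferInstance, fun h => hb (by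
    have : Subsingleton L := Subgroup.subsingleton_iff.mp (subsingleton_of_bot_eq_top h)
    exact Subgroup.eq_bot_of_subsingleton L)⟩
  obtain ⟨K, hK, hmax⟩ := (Set.toFinite S).exists_maximal hS
  have hKn := hK.1
  have hle : K.map L.subtype ≤ L := Subgroup.map_subtype_le K
  have hsub : (K.map L.subtype).subgroupOf L = K := by
    rw [Subgroup.subgroupOf, Subgroup.comap_map_eq_self_of_injective L.subtype_injective]
  have hsimple : IsSimpleGroup (L ⧸ K) := by
    have : Nontrivial (L ⧸ K) := QuotientGroup.nontrivial_iff.mpr hK.2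
    refine ⟨fun M hM => ?_⟩
    have hcm : (M.comap (QuotientGroup.mk' K)).Normal := hM.comap _
    have hKle : K ≤ M.comap (QuotientGroup.mk' K) := by
      intro k hk
      rw [Subgroup.mem_comap]
      have : QuotientGroup.mk' K k = 1 := (QuotientGroup.eq_one_iff k).mpr hk
      rw [this]; exact one_mem _
    have hsurj := QuotientGroup.mk'_surjective K
    by_cases ht : M.comap (QuotientGroup.mk' K) = ⊤
    · right
      rw [← Subgroup.map_comap_eq_self_of_surjective hsurj M, ht,
        Subgroup.map_top_of_surjective _ hsurj]
    · left
      have := le_antisymm (hmax ⟨hcm, ht⟩ hKle) hKle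
      rw [← Subgroup.map_comap_eq_self_of_surjective hsurj M, this]
      exact QuotientGroup.map_mk'_self K
  have hlt : Nat.card (K.map L.subtype) < c := by
    rw [Subgroup.card_subtype, ← hL]
    refine lt_of_le_of_ne (Subgroup.card_le_card_group K) fun h => hK.2 ?_
    exact Subgroup.eq_top_of_card_eq K h
  obtain ⟨n, s, s0, sl, hs⟩ := ih _ hlt (K.map L.subtype) rfl
  refine ⟨n + 1, Fin.snoc s L, ?_, by simp, ?_⟩
  · have := Fin.snoc_castSucc (α := fun _ => Subgroup G) L s 0
    simpa [s0] using this
  · intro i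
    refine Fin.lastCases ?_ (fun i => ?_) i
    · rw [Fin.snoc_castSucc, Fin.succ_last, Fin.snoc_last, sl]
      refine ⟨hle, ?_⟩
      rw [hsub]
      exact ⟨hKn, hsimple⟩
    · rw [Fin.snoc_castSucc, Fin.succ_castSucc, Fin.snoc_castSucc]
      exact hs i

lemma IsPiSolvable.subSep {μ : Set ℕ} {G : Type*} [Group G] [Finite G] (h : IsPiSolvable μ G) :
    SubSep μ (⊤ : Subgroup G) := by
  obtain ⟨n, s, hs⟩ := exists_comp_series _ (⊤ : Subgroup G) rfl
  have hs' : IsCompositionSeries s := hs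
  have key : ∀ i : Fin (n + 1), SubSep μ (s i) := by
    intro i
    induction i using Fin.induction with
    | zero => rw [hs.1]; exact SubSep.bot
    | succ i ih =>
      obtain ⟨h1, h2, h3⟩ := hs.2.2 i
      refine SubSep.step _ _ ih h1
        ((Subgroup.normal_subgroupOf_iff_le_normalizer h1).mp h2) ?_
      rcases h n s hs' i with h4 | ⟨p, hp, hpp, h4, -⟩
      · right
        intro q hq hqd hqm
        exact h4 q hqm hqd
      · left
        intro q hq hqd
        change q ∣ Nat.card _ at hqd
        rw [h4, Nat.prime_dvd_prime_iff_eq hq hpp] at hqd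
        rw [hqd]; exact hp
  rw [← hs.2.1]
  exact key _

lemma piPart_ne_zero (π : Set ℕ) (n : ℕ) : piPart π n ≠ 0 := by
  unfold piPart
  refine Finset.prod_ne_zero_iff.mpr fun q hq => ?_
  have hq' : q.Prime := Nat.prime_of_mem_primeFactors (by simpa using hq)
  by_cases h : q ∈ π
  · simpa [h] using fun h0 => absurd h0 hq'.ne_zero
  · simp [h]

lemma piPart_union (μ ν π : Set ℕ) (hd : ∀ q ∈ μ, q ∉ ν) (hπ : π = μ ∪ ν) (n : ℕ) :
    piPart π n = piPart μ n * piPart ν n := by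
  subst hπ
  unfold piPart
  rw [← Finsupp.prod_mul]
  refine Finsupp.prod_congr fun q _ => ?_
  by_cases h : q ∈ μ
  · simp [h, hd q h]
  · simp [h]

lemma piPart_univ {n : ℕ} (hn : n ≠ 0) : piPart Set.univ n = n := by
  unfold piPart
  simpa using Nat.prod_factorization_pow_eq_self hn

lemma piPart_primesIn (π : Set ℕ) (n : ℕ) : PrimesIn (· ∈ π) (piPart π n) := by
  intro q hq hd
  unfold piPart at hd
  obtain ⟨r, hr, hqr⟩ := (Nat.Prime.prime hq).exists_mem_finset_dvd hd
  have hr' : r.Prime := Nat.prime_of_mem_primeFactors (by simpa using hr)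
  by_cases h : r ∈ π
  · simp only [h, if_true] at hqr
    have := (Nat.prime_dvd_prime_iff_eq hq hr').mp (hq.dvd_of_dvd_pow hqr)
    change q ∈ π
    rw [this]; exact h
  · simp only [h, if_false, Nat.dvd_one] at hqr
    exact absurd hqr hq.ne_one

/-- the map sending the class of `z` in the centralizer of `h` to the class of `h z`. -/
noncomputable def classMap {G : Type*} [Group G] (h : G) :
    ConjClasses (Subgroup.centralizer {h}) → ConjClasses G :=
  Quotient.lift (fun z => ConjClasses.mk (h * z)) (by
    rintro a b hab
    obtain ⟨c, hc⟩ := isConj_iff.mp hab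
    refine ConjClasses.mk_eq_mk_iff_isConj.mpr (isConj_iff.mpr ⟨c, ?_⟩)
    have hch : (c : G) * h = h * c := Subgroup.mem_centralizer_singleton_iff.mp c.2
    rw [← hc]
    push_cast
    rw [← mul_assoc, hch]
    simp [mul_assoc])

lemma classMap_mk {G : Type*} [Group G] (h : G) (z : Subgroup.centralizer {h}) :
    classMap h (ConjClasses.mk z) = ConjClasses.mk (h * (z : G)) := rfl

lemma exists_exponent {G : Type*} [Group G] [Finite G] (p : ℕ) (hp : p.Prime) :
    ∃ e : ℕ, (∀ x : G, ¬ p ∣ orderOf x → x ^ e = x) ∧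
      (∀ x : G, IsPiElement {p} x → x ^ e = 1) ∧
      (∀ x : G, ¬ p ∣ orderOf (x ^ e)) ∧ (∀ x : G, IsPiElement {p} ((x ^ e)⁻¹ * x)) := by
  obtain ⟨a, m, hm, hcard⟩ := Nat.exists_eq_pow_mul_and_not_dvd
    (Nat.card_pos (α := G)).ne' p hp.ne_one
  have hcop : (p ^ a).Coprime m := Nat.Coprime.pow_left a ((Nat.Prime.coprime_iff_not_dvd hp).mpr hm)
  obtain ⟨e, e0, e1⟩ := Nat.chineseRemainder hcop 0 1
  have hpe : p ^ a ∣ e := (Nat.modEq_zero_iff_dvd).mp e0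
  have hord : ∀ x : G, orderOf x ∣ p ^ a * m := fun x => hcard ▸ orderOf_dvd_natCard x
  refine ⟨e, fun x hx => ?_, fun x hx => ?_, fun x hx => ?_, fun x => ?_⟩
  · have h1 : orderOf x ∣ m := by
      refine Nat.Coprime.dvd_of_dvd_mul_left ?_ (hord x)
      exact (Nat.Coprime.pow_left a ((Nat.Prime.coprime_iff_not_dvd hp).mpr hx)).symm
    have := pow_eq_pow_iff_modEq.mpr (Nat.ModEq.of_dvd h1 e1)
    simpa using this
  · have h1 : orderOf x ∣ p ^ a := by
      refine Nat.Coprime.dvd_of_dvd_mul_right ?_ (hord x)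
      refine Nat.coprime_of_dvd fun q hq h1 h2 => ?_
      have : q = p := hx q hq h1
      exact hm (this ▸ h2)
    exact orderOf_dvd_iff_pow_eq_one.mp (h1.trans hpe)
  · apply hm
    refine hx.trans (orderOf_dvd_of_pow_eq_one ?_)
    rw [← pow_mul]
    exact orderOf_dvd_iff_pow_eq_one.mp ((hord x).trans (Nat.mul_dvd_mul_right hpe m))
  · have h1 : ((x ^ e)⁻¹ * x) ^ (p ^ a) = 1 := by
      have hc : Commute (x ^ e)⁻¹ x := (Commute.pow_self x e).inv_left
      rw [hc.mul_pow, inv_pow, ← pow_mul, inv_mul_eq_one]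
      have : e * p ^ a ≡ 1 * p ^ a [MOD orderOf x] := by
        refine Nat.ModEq.of_dvd (hord x) ?_
        rw [mul_comm (p ^ a) m]
        exact Nat.ModEq.mul_right' _ e1
      simpa using pow_eq_pow_iff_modEq.mpr this
    intro q hq hd
    have := hd.trans (orderOf_dvd_of_pow_eq_one h1)
    exact (Nat.prime_dvd_prime_iff_eq hq hp).mp (hq.dvd_of_dvd_pow this)

lemma isPiElement_coe {G : Type*} [Group G] {π : Set ℕ} {K : Subgroup G} (x : K) :
    IsPiElement π (x : G) ↔ IsPiElement π x := by
  unfold IsPiElement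
  rw [Subgroup.orderOf_coe]

lemma kPi_eq_sum {G : Type*} [Group G] [Finite G] (μ : Set ℕ) (p : ℕ) (π : Set ℕ)
    (hp : p.Prime) (hpμ : p ∉ μ) (hπ : π = μ ∪ {p}) (H : Subgroup G)
    (hHμ : ∀ h ∈ H, IsPiElement μ h)
    (hsurj : ∀ x : G, IsPiElement μ x → ∃ g : G, g * x * g⁻¹ ∈ H)
    (hinj : ∀ h ∈ H, ∀ h' ∈ H, IsConj h h' → h = h') :
    kPi π G = ∑ᶠ h : H, kPi {p} (Subgroup.centralizer {(h : G)}) := by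
  obtain ⟨e, he1, he2, he3, he4⟩ := exists_exponent (G := G) p hp
  have hnp : ∀ h : G, IsPiElement μ h → ¬ p ∣ orderOf h := fun h hh hd => hpμ (hh p hp hd)
  have hpow : ∀ h ∈ H, ∀ z : Subgroup.centralizer {h}, IsPiElement {p} z →
      (h * (z : G)) ^ e = h := by
    intro h hh z hz
    have hc : Commute h (z : G) := (Subgroup.mem_centralizer_singleton_iff.mp z.2).symm
    rw [hc.mul_pow, he1 h (hnp h (hHμ h hh)), he2 _ ((isPiElement_coe z).mpr hz), mul_one]
  have := Fintype.ofFinite H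
  let A : H → Type _ := fun h => {c : ConjClasses (Subgroup.centralizer {(h : G)}) |
    ∃ x, ConjClasses.mk x = c ∧ IsPiElement {p} x}
  have hmaps : ∀ s : (Σ h : H, A h), ∃ x : G, ConjClasses.mk x = classMap (s.1 : G) s.2.1 ∧
      IsPiElement π x := by
    rintro ⟨h, c, z, rfl, hz⟩
    refine ⟨h * z, rfl, ?_⟩
    have hc : Commute (h : G) (z : G) := (Subgroup.mem_centralizer_singleton_iff.mp z.2).symm
    intro q hq hd
    have hd' := hd.trans hc.orderOf_mul_dvd_mul_orderOf
    rw [hπ]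
    rcases hq.dvd_mul.mp hd' with h1 | h1
    · exact Or.inl (hHμ h h.2 q hq h1)
    · exact Or.inr ((isPiElement_coe z).mpr hz q hq h1)
  let f : (Σ h : H, A h) → {c : ConjClasses G | ∃ x : G, ConjClasses.mk x = c ∧ IsPiElement π x} :=
    fun s => ⟨classMap (s.1 : G) s.2.1, hmaps s⟩
  have hf : Function.Bijective f := by
    constructor
    · rintro ⟨h, c, z, rfl, hz⟩ ⟨h', c', z', rfl, hz'⟩ heq
      have heq' : ConjClasses.mk ((h : G) * z) = ConjClasses.mk ((h' : G) * z') :=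
        congrArg Subtype.val heq
      obtain ⟨g, hg⟩ := isConj_iff.mp (ConjClasses.mk_eq_mk_iff_isConj.mp heq')
      have h1 : g * (h : G) * g⁻¹ = h' := by
        rw [← hpow h h.2 z hz, ← hpow h' h'.2 z' hz', ← hg, conj_pow]
      have h2 : h = h' := Subtype.ext (hinj h h.2 h' h'.2 (isConj_iff.mpr ⟨g, h1⟩))
      subst h2
      have hgc : g ∈ Subgroup.centralizer {(h : G)} :=
        Subgroup.mem_centralizer_singleton_iff.mpr (mul_inv_eq_iff_eq_mul.mp h1)
      have h3 : ConjClasses.mk z = ConjClasses.mk z' := by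
        refine ConjClasses.mk_eq_mk_iff_isConj.mpr (isConj_iff.mpr ⟨⟨g, hgc⟩, ?_⟩)
        apply Subtype.ext
        push_cast
        have h4 : g * (h : G) * g⁻¹ * (g * (z : G) * g⁻¹) = h * z' := by
          rw [← hg]; simp [mul_assoc]
        rw [h1] at h4
        exact mul_left_cancel h4
      congr 1
      exact Subtype.ext h3
    · rintro ⟨c, x, rfl, hx⟩
      have hxe : IsPiElement μ (x ^ e) := by
        intro q hq hd
        have h1 := hx q hq (hd.trans (orderOf_pow_dvd e))
        rw [hπ] at h1
        rcases h1 with h1 | h1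
        · exact h1
        · rw [Set.mem_singleton_iff] at h1
          exact absurd (h1 ▸ hd) (he3 x)
      obtain ⟨g, hg⟩ := hsurj _ hxe
      obtain ⟨y, hy⟩ : ∃ y, y = g * x * g⁻¹ := ⟨_, rfl⟩
      have hye : y ^ e ∈ H := by rw [hy, conj_pow]; exact hg
      have hzc : (y ^ e)⁻¹ * y ∈ Subgroup.centralizer {y ^ e} := by
        rw [Subgroup.mem_centralizer_singleton_iff]
        have hc : Commute (y ^ e) y := Commute.pow_self y e
        exact ((Commute.refl (y ^ e)).inv_left.mul_left hc.symm).eq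
      refine ⟨⟨⟨y ^ e, hye⟩, ⟨ConjClasses.mk ⟨(y ^ e)⁻¹ * y, hzc⟩, _, rfl, ?_⟩⟩, ?_⟩
      · exact (isPiElement_coe _).mp (he4 y)
      · apply Subtype.ext
        change ConjClasses.mk (y ^ e * ((y ^ e)⁻¹ * y)) = ConjClasses.mk x
        rw [mul_inv_cancel_left]
        exact ConjClasses.mk_eq_mk_iff_isConj.mpr (isConj_iff.mpr ⟨g, hy.symm⟩).symm
  have hcard := Nat.card_congr (Equiv.ofBijective f hf)
  rw [Nat.card_sigma] at hcard
  rw [finsum_eq_sum_of_fintype]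
  exact hcard.symm

/-- If `π` is the disjoint union of `μ` and `{p}`, `G` is `μ`-solvable with
`d_μ(G) = 1`, and `H` is a Hall `μ`-subgroup of `G`, then
`d_π(G) = (1/|H|) ∑_{h ∈ H} k_p(C_G(h))/|G|_p`. -/
theorem dPi_eq_average_kP_centralizer
    {G : Type*} [Group G] [Finite G] (μ : Set ℕ) (p : ℕ) (π : Set ℕ)
    (hμ : ∀ q ∈ μ, Nat.Prime q) (hp : p.Prime) (hpμ : p ∉ μ)
    (hπ : π = μ ∪ {p})
    (hsolv : IsPiSolvable μ G) (hdμ : dPi μ G = 1)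
    (H : Subgroup G) (hH : Nat.card H = piPart μ (Nat.card G)) :
    dPi π G = (1 / (Nat.card H : ℚ)) *
      ∑ᶠ h : H, (kPi {p} (Subgroup.centralizer {(h : G)}) : ℚ) /
        (piPart {p} (Nat.card G) : ℚ) := by

  have hn : Nat.card G ≠ 0 := Nat.card_pos.ne'
  have hHc : PrimesIn (· ∈ μ) (Nat.card H) := hH ▸ piPart_primesIn μ _
  have hHi : PrimesIn (fun q => ¬ q ∈ μ) H.index := by
    have h1 : Nat.card H * H.index = piPart μ (Nat.card G) * piPart μᶜ (Nat.card G) := by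
      rw [Subgroup.card_mul_index, ← piPart_union μ μᶜ Set.univ (by simp) (by simp),
        piPart_univ hn]
    rw [hH] at h1
    rw [Nat.eq_of_mul_eq_mul_left (Nat.pos_of_ne_zero (piPart_ne_zero _ _)) h1]
    exact piPart_primesIn μᶜ _
  have hHμ : ∀ h ∈ H, IsPiElement μ h := fun h hh =>
    hHc.of_dvd (Subgroup.orderOf_dvd_natCard H hh)
  have hsurj : ∀ x : G, IsPiElement μ x → ∃ g : G, g * x * g⁻¹ ∈ H := fun x hx =>
    exists_conj_mem_hall μ _ G rfl hsolv.subSep H hHc hHi x hx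
  have hk : kPi μ G = Nat.card H := by
    rw [hH]
    unfold dPi at hdμ
    rw [div_eq_one_iff_eq (by exact_mod_cast piPart_ne_zero _ _)] at hdμ
    exact_mod_cast hdμ
  let φ : H → {c : ConjClasses G | ∃ x : G, ConjClasses.mk x = c ∧ IsPiElement μ x} :=
    fun h => ⟨ConjClasses.mk (h : G), h, rfl, hHμ h h.2⟩
  have hφs : Function.Surjective φ := by
    rintro ⟨c, x, rfl, hx⟩
    obtain ⟨g, hg⟩ := hsurj x hx
    refine ⟨⟨_, hg⟩, Subtype.ext ?_⟩
    exact ConjClasses.mk_eq_mk_iff_isConj.mpr (isConj_iff.mpr ⟨g, rfl⟩).symm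
  have hφ : Function.Bijective φ := hφs.bijective_of_nat_card_le hk.ge
  have hinj : ∀ h ∈ H, ∀ h' ∈ H, IsConj h h' → h = h' := by
    intro h hh h' hh' hc
    have : φ ⟨h, hh⟩ = φ ⟨h', hh'⟩ := Subtype.ext (ConjClasses.mk_eq_mk_iff_isConj.mpr hc)
    exact congrArg Subtype.val (hφ.1 this)
  have hsum := kPi_eq_sum μ p π hp hpμ hπ H hHμ hsurj hinj
  have := Fintype.ofFinite H
  rw [finsum_eq_sum_of_fintype] at hsum ⊢
  rw [← Finset.sum_div]
  unfold dPi
  rw [hsum, piPart_union μ {p} π (fun q hq h => hpμ (by rw [← Set.mem_singleton_iff.mp h]; exact hq)) hπ,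
    hH]
  have h1 : (piPart μ (Nat.card G) : ℚ) ≠ 0 := by exact_mod_cast piPart_ne_zero _ _
  have h2 : (piPart {p} (Nat.card G) : ℚ) ≠ 0 := by exact_mod_cast piPart_ne_zero _ _
  push_cast
  field_simp
end

section
/- Let G be a finite group and π a non-empty set of primes. If d_p(G) = 1 for every prime p ∈ π, then G contains a normal π-complement and G is π-solvable. -/
open scoped Classical Pointwise

theorem piPart_singleton_aux (p n : ℕ) :
    piPart {p} n = p ^ n.factorization p := by
  unfold piPart
  simp only [Set.mem_singleton_iff]
  rw [Finsupp.prod, Finset.prod_ite_eq' n.factorization.support p (fun q => q ^ n.factorization q)]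
  split_ifs with h
  · rfl
  · rw [Finsupp.notMem_support_iff.mp h, pow_zero]

theorem piPart_eq_aux (π : Set ℕ) (n : ℕ) :
    piPart π n = ∏ p ∈ n.primeFactors.filter (· ∈ π), p ^ n.factorization p := by
  unfold piPart
  rw [Finset.prod_filter]
  rfl

/-- If `d_p(G) = 1` no two distinct elements of a Sylow `p`-subgroup are conjugate. -/
theorem sylow_conj_eq_aux {G : Type*} [Group G] [Finite G] (p : ℕ) [hp : Fact p.Prime]
    (hd : dPi {p} G = 1) (P : Sylow p G) (x y : G) (hx : x ∈ P) (hy : y ∈ P)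
    (hxy : IsConj x y) : x = y := by
  have hk : kPi {p} G = Nat.card P := by
    rw [P.card_eq_multiplicity, ← piPart_singleton_aux]
    have h0 : piPart {p} (Nat.card G) ≠ 0 := by
      rw [piPart_singleton_aux]
      exact pow_ne_zero _ hp.out.ne_zero
    unfold dPi at hd
    rw [div_eq_one_iff_eq (by exact_mod_cast h0)] at hd
    exact_mod_cast hd
  let f : P → {c : ConjClasses G | ∃ x : G, ConjClasses.mk x = c ∧ IsPiElement {p} x} :=
    fun z => ⟨ConjClasses.mk (z : G), z, rfl, by
      intro q hq hqd
      obtain ⟨k, hk⟩ := P.isPGroup'.exists_orderOf_eq_pow z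
      rw [Subgroup.orderOf_coe, hk] at hqd
      exact (Nat.prime_dvd_prime_iff_eq hq hp.out).mp (hq.dvd_of_dvd_pow hqd)⟩
  have hf : Function.Surjective f := by
    rintro ⟨c, z, rfl, hz⟩
    have hzp : IsPGroup p (Subgroup.zpowers z) := by
      rw [IsPGroup.iff_card]
      refine ⟨(orderOf z).primeFactorsList.length, ?_⟩
      rw [Nat.card_zpowers]
      exact Nat.eq_prime_pow_of_unique_prime_dvd (orderOf_pos z).ne' (fun {d} h1 h2 => hz d h1 h2)
    obtain ⟨Q, hQ⟩ := hzp.exists_le_sylow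
    obtain ⟨g, hg⟩ := MulAction.exists_smul_eq G Q P
    have hzQ : z ∈ Q := hQ (Subgroup.mem_zpowers z)
    have : g * z * g⁻¹ ∈ P := by
      rw [← hg]
      exact Subgroup.smul_mem_pointwise_smul z (MulAut.conj g) (Q : Subgroup G) hzQ
    refine ⟨⟨_, this⟩, Subtype.ext ?_⟩
    exact (ConjClasses.mk_eq_mk_iff_isConj.mpr (isConj_iff.mpr ⟨g, rfl⟩)).symm
  have hb := (Nat.bijective_iff_surjective_and_card f).mpr ⟨hf, hk.symm⟩
  have := @hb.1 ⟨x, hx⟩ ⟨y, hy⟩ (Subtype.ext (ConjClasses.mk_eq_mk_iff_isConj.mpr hxy))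
  exact congrArg Subtype.val this

theorem normal_p_complement_aux {G : Type*} [Group G] [Finite G] (p : ℕ) (hp : p.Prime)
    (hd : dPi {p} G = 1) :
    ∃ N : Subgroup G, N.Normal ∧ ¬ p ∣ Nat.card N ∧
      N.index = p ^ (Nat.card G).factorization p := by
  have : Fact p.Prime := ⟨hp⟩
  obtain ⟨P⟩ : Nonempty (Sylow p G) := inferInstance
  have hP : Subgroup.normalizer (P : Set G) ≤ Subgroup.centralizer (P : Set G) := by
    intro g hg
    rw [Subgroup.mem_centralizer_iff]
    intro x hx
    have h1 := sylow_conj_eq_aux p hd P x (g * x * g⁻¹) hx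
      ((Subgroup.mem_normalizer_iff.mp hg x).mp hx) (isConj_iff.mpr ⟨g, rfl⟩)
    nth_rewrite 1 [h1]
    group
  refine ⟨(MonoidHom.transferSylow P hP).ker, inferInstance,
    MonoidHom.not_dvd_card_ker_transferSylow P hP, ?_⟩
  rw [← P.card_eq_multiplicity]
  exact (MonoidHom.ker_transferSylow_isComplement' P hP).symm.index_eq_card

theorem simple_quotient_aux {H S : Type*} [Group H] [Finite H] [Group S] [IsSimpleGroup S]
    (p : ℕ) (hp : p.Prime) (f : H →* S) (hf : Function.Surjective f)
    (M : Subgroup H) (hM : M.Normal) (hpM : ¬ p ∣ Nat.card M) (k : ℕ) (hk : M.index ∣ p ^ k)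
    (hpS : p ∣ Nat.card S) : Nat.card S = p ∧ IsCyclic S := by
  have : Fact p.Prime := ⟨hp⟩
  have : Finite S := Finite.of_surjective f hf
  rcases (hM.map f hf).eq_bot_or_eq_top with h | h
  · have h1 : Nat.card S ∣ p ^ k := by
      have := Subgroup.index_map_dvd M hf
      rw [h, Subgroup.index_bot] at this
      exact this.trans hk
    obtain ⟨j, -, hj⟩ := (Nat.dvd_prime_pow hp).mp h1
    have hPG : IsPGroup p S := IsPGroup.of_card hj
    have hc : Subgroup.center S = ⊤ := by
      rcases (inferInstance : (Subgroup.center S).Normal).eq_bot_or_eq_top with h | h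
      · have := hPG.center_nontrivial
        exact absurd h (Subgroup.nontrivial_iff_ne_bot _ |>.mp this)
      · exact h
    let _ : CommGroup S := Group.commGroupOfCenterEqTop hc
    have hpr := (CommGroup.is_simple_iff_prime_card (α := S)).mp inferInstance
    have he : Nat.card S = p := ((Nat.prime_dvd_prime_iff_eq hp hpr).mp hpS).symm
    exact ⟨he, isCyclic_of_prime_card he⟩
  · exfalso
    apply hpM
    have := Subgroup.card_map_dvd M f
    rw [h, Subgroup.card_top] at this
    exact hpS.trans this

/-- If `d_p(G) = 1` for every `p ∈ π` (π a non-empty set of primes), then `G`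
contains a normal `π`-complement and `G` is `π`-solvable. -/
theorem normal_pi_complement_of_dP_eq_one
    {G : Type*} [Group G] [Finite G] (π : Set ℕ)
    (hπ : ∀ p ∈ π, Nat.Prime p) (hne : π.Nonempty)
    (hd : ∀ p ∈ π, dPi {p} G = 1) :
    (∃ N : Subgroup G, N.Normal ∧ (∀ p ∈ π, ¬ p ∣ Nat.card N) ∧
      N.index = piPart π (Nat.card G)) ∧
    IsPiSolvable π G := by
  choose! N hN hNp hNi using fun p hp => normal_p_complement_aux p (hπ p hp) (hd p hp)
  refine ⟨?_, ?_⟩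
  · let T := (Nat.card G).primeFactors.filter (· ∈ π)
    have hT : ∀ p : T, (p : ℕ) ∈ π := fun p => (Finset.mem_filter.mp p.2).2
    have hG0 : Nat.card G ≠ 0 := Nat.card_pos.ne'
    refine ⟨⨅ p : T, N p, ?_, ?_, ?_⟩
    · exact Subgroup.normal_iInf_normal fun p => hN p (hT p)
    · intro p hp hpd
      have hpT : p ∈ T := Finset.mem_filter.mpr
        ⟨Nat.mem_primeFactors.mpr ⟨hπ p hp, hpd.trans (Subgroup.card_subgroup_dvd_card _), hG0⟩, hp⟩
      exact hNp p hp (hpd.trans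
        (Subgroup.card_dvd_of_le (iInf_le (fun p : T => N p) ⟨p, hpT⟩)))
    · rw [piPart_eq_aux]
      apply le_antisymm
      · refine (Subgroup.index_iInf_le _).trans ?_
        have h1 : ∏ p : T, (N p).index = ∏ p : T, (p : ℕ) ^ (Nat.card G).factorization p :=
          Finset.prod_congr rfl fun p _ => hNi p (hT p)
        exact (h1.trans
          (Finset.prod_coe_sort T (fun p => p ^ (Nat.card G).factorization p))).le
      · refine Nat.le_of_dvd (Nat.pos_of_ne_zero Subgroup.index_ne_zero_of_finite) ?_
        refine Finset.prod_dvd_of_isRelPrime ?_ ?_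
        · intro p hp q hq hpq
          have h1 := (Finset.mem_filter.mp hp).2
          have h2 := (Finset.mem_filter.mp hq).2
          exact Nat.coprime_iff_isRelPrime.mp
            (((Nat.coprime_primes (hπ p h1) (hπ q h2)).mpr hpq).pow _ _)
        · intro p hp
          rw [← hNi p (Finset.mem_filter.mp hp).2]
          exact Subgroup.index_dvd_of_le (iInf_le (fun p : T => N p) ⟨p, hp⟩)
  · intro n s hs i
    by_cases h : ∀ q ∈ π,
        ¬ q ∣ Nat.card (s i.succ ⧸ (s i.castSucc).subgroupOf (s i.succ))
    · exact Or.inl h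
    · right
      push Not at h
      obtain ⟨p, hp, hpd⟩ := h
      have := (hs.2.2 i).2.choose
      have := (hs.2.2 i).2.choose_spec
      have key := simple_quotient_aux p (hπ p hp)
        (QuotientGroup.mk' ((s i.castSucc).subgroupOf (s i.succ)))
        (QuotientGroup.mk'_surjective _) ((N p).subgroupOf (s i.succ))
        ((hN p hp).subgroupOf _)
        (fun h => hNp p hp (h.trans (Subgroup.card_comap_dvd_of_injective _ _
          (Subgroup.subtype_injective _))))
        ((Nat.card G).factorization p)
        (by
          have := hN p hp
          rw [← hNi p hp]
          exact Subgroup.relIndex_dvd_index_of_normal _ _) hpd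
      exact ⟨p, hp, hπ p hp, key.1, key.2⟩
end
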